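/- Assume n ≥ 2 and n ≢ 0 (mod ℓ). Then for every 0 ≤ i ≤ N = ⌊n/ℓ⌋ and every j ∈ Z/ℓ: if j ≢ n−1 (mod ℓ) then ẽ_j μ_i^{(n)} = 0, while if j ≡ n−1 (mod ℓ) then ẽ_j μ_i^{(n)} = μ_i^{(n−1)} (which is defined, since ⌊(n−1)/ℓ⌋ = N when ℓ does not divide n). -/

import Mathlib

noncomputable section

open scoped BigOperators Classical

namespace FockCrystal

variable (ℓ : ℕ)

/-- The `ℓ`-residue of a cell `(r, c)` (0-indexed rows and columns): `(c - r) mod ℓ`. -/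
def res (x : ℕ × ℕ) : ZMod ℓ := (((x.2 : ℤ) - (x.1 : ℤ) : ℤ) : ZMod ℓ)

/-- `x` is an addable cell of `μ`: `x ∉ μ` and `μ ∪ {x}` is again a Young diagram. -/
def IsAddableCell (μ : YoungDiagram) (x : ℕ × ℕ) : Prop :=
  x ∉ μ ∧ IsLowerSet (insert x (μ.cells : Set (ℕ × ℕ)))

/-- `x` is a removable cell of `μ`: `x ∈ μ` and `μ \ {x}` is again a Young diagram. -/
def IsRemovableCell (μ : YoungDiagram) (x : ℕ × ℕ) : Prop :=
  x ∈ μ ∧ IsLowerSet ((μ.cells.erase x : Finset (ℕ × ℕ)) : Set (ℕ × ℕ))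

/-- The finite set of `i`-addable cells of `μ`. -/
def addables (i : ZMod ℓ) (μ : YoungDiagram) : Finset (ℕ × ℕ) :=
  (Finset.range (μ.cells.card + 1) ×ˢ Finset.range (μ.cells.card + 1)).filter
    fun x => IsAddableCell μ x ∧ res ℓ x = i

/-- The finite set of `i`-removable cells of `μ`. -/
def removables (i : ZMod ℓ) (μ : YoungDiagram) : Finset (ℕ × ℕ) :=
  μ.cells.filter fun x => IsRemovableCell μ x ∧ res ℓ x = i

/-- Adding a cell to a Young diagram (returns `μ` unchanged if the result would not be a
Young diagram). -/
def addCell (μ : YoungDiagram) (x : ℕ × ℕ) : YoungDiagram :=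
  if h : IsLowerSet (insert x (μ.cells : Set (ℕ × ℕ))) then
    ⟨insert x μ.cells, by simpa using h⟩
  else μ

/-- Removing a cell from a Young diagram (returns `μ` unchanged if the result would not be
a Young diagram). -/
def eraseCell (μ : YoungDiagram) (x : ℕ × ℕ) : YoungDiagram :=
  if h : IsLowerSet ((μ.cells.erase x : Finset (ℕ × ℕ)) : Set (ℕ × ℕ)) then
    ⟨μ.cells.erase x, h⟩
  else μ

/-- The letter (`some true` = `A` for addable, `some false` = `R` for removable) contributed
to the `i`-word of `μ` by row `r`; for a fixed residue a row contributes at most one letter. -/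
def rowLetter (i : ZMod ℓ) (μ : YoungDiagram) (r : ℕ) : Option Bool :=
  if ∃ c, (r, c) ∈ addables ℓ i μ then some true
  else if ∃ c, (r, c) ∈ removables ℓ i μ then some false
  else none

/-- The `i`-word of `μ`, read from the bottom row up, with each letter recorded together
with its row index. -/
def wordP (i : ZMod ℓ) (μ : YoungDiagram) : List (Bool × ℕ) :=
  ((List.range (μ.cells.card + 2)).reverse).filterMap fun r =>
    (rowLetter ℓ i μ r).map fun b => (b, r)

/-- One step of the `AR`-cancellation (stack algorithm): an `R` cancels a directly
preceding `A`. -/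
def cancelStep (st : List (Bool × ℕ)) (c : Bool × ℕ) : List (Bool × ℕ) :=
  if c.1 = false ∧ (st.getLast?.map Prod.fst) = some true then st.dropLast else st ++ [c]

/-- Repeatedly delete adjacent occurrences of `AR` until none remain (computed by the
one-pass stack algorithm, which yields the unique `AR`-reduced word `R…RA…A`). -/
def reduceWord (w : List (Bool × ℕ)) : List (Bool × ℕ) := w.foldl cancelStep []

/-- The row of the `i`-good cell of `μ`: the removable cell corresponding to the rightmost
`R` remaining in the reduced `i`-word (if any). -/
def goodRow (i : ZMod ℓ) (μ : YoungDiagram) : Option ℕ :=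
  (((reduceWord (wordP ℓ i μ)).filter fun p => p.1 = false).getLast?).map Prod.snd

/-- The row of the `i`-cogood cell of `μ`: the addable cell corresponding to the leftmost
`A` remaining in the reduced `i`-word (if any). -/
def cogoodRow (i : ZMod ℓ) (μ : YoungDiagram) : Option ℕ :=
  (((reduceWord (wordP ℓ i μ)).filter fun p => p.1 = true).head?).map Prod.snd

/-- The Kashiwara operator `ẽᵢ`: remove the `i`-good cell if there is one, else `0`
(modelled by `Option`, `none = 0`). -/
def etilde (i : ZMod ℓ) (μ : YoungDiagram) : Option YoungDiagram :=
  (goodRow ℓ i μ).map fun r => eraseCell μ (r, μ.rowLen r - 1)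

/-- The Kashiwara operator `f̃ᵢ`: add the `i`-cogood cell if there is one, else `0`
(modelled by `Option`, `none = 0`). -/
def ftilde (i : ZMod ℓ) (μ : YoungDiagram) : Option YoungDiagram :=
  (cogoodRow ℓ i μ).map fun r => addCell μ (r, μ.rowLen r)

/-- The list of row lengths of the partition `μ_i^{(n)}`:
`μ₀^{(n)} = (n)`, and for `1 ≤ i ≤ N = ⌊n/ℓ⌋`,
`μ_i^{(n)} = ((N-i)ℓ + ℓ-1, (ℓ-1)^q, s)` where `n - ((N-i)ℓ + ℓ-1) = q(ℓ-1) + s`,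
`0 ≤ s ≤ ℓ-2`, and the last part `s` is omitted when `s = 0`. -/
def muList (ℓ n i : ℕ) : List ℕ :=
  if i = 0 then [n]
  else
    ((n / ℓ - i) * ℓ + (ℓ - 1)) ::
      (List.replicate ((n - ((n / ℓ - i) * ℓ + (ℓ - 1))) / (ℓ - 1)) (ℓ - 1)
        ++ (if (n - ((n / ℓ - i) * ℓ + (ℓ - 1))) % (ℓ - 1) = 0 then []
            else [(n - ((n / ℓ - i) * ℓ + (ℓ - 1))) % (ℓ - 1)]))

theorem mem_iff_lt (μ : YoungDiagram) (r c : ℕ) : (r, c) ∈ μ.cells ↔ c < μ.rowLen r := by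
  rw [YoungDiagram.mem_cells]; exact YoungDiagram.mem_iff_lt_rowLen

theorem isAddable_iff (μ : YoungDiagram) (r c : ℕ) :
    IsAddableCell μ (r, c) ↔ c = μ.rowLen r ∧ (r = 0 ∨ μ.rowLen r < μ.rowLen (r - 1)) := by
  unfold IsAddableCell
  rw [← YoungDiagram.mem_cells, mem_iff_lt]
  constructor
  · rintro ⟨h1, h2⟩
    have hc : c = μ.rowLen r := by
      by_contra hne
      have hlt : μ.rowLen r < c := by omega
      have := h2 (a := (r, c)) (b := (r, μ.rowLen r)) ⟨le_refl _, by simpa using hlt.le⟩ (by simp)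
      rcases this with h | h
      · simp at h; omega
      · rw [Finset.mem_coe, mem_iff_lt] at h; omega
    refine ⟨hc, ?_⟩
    rcases Nat.eq_zero_or_pos r with h0 | h0
    · exact Or.inl h0
    right
    have := h2 (a := (r, c)) (b := (r - 1, c)) ⟨by simp, by simp⟩ (by simp)
    rcases this with h | h
    · simp at h; omega
    · rw [Finset.mem_coe, mem_iff_lt] at h; omega
  · rintro ⟨rfl, h⟩
    refine ⟨lt_irrefl _, ?_⟩
    rintro ⟨x, y⟩ ⟨x', y'⟩ hle hm
    have hx : x' ≤ x := hle.1
    have hy : y' ≤ y := hle.2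
    rcases hm with hm | hm
    · simp only [Prod.mk.injEq] at hm
      obtain ⟨rfl, rfl⟩ := hm
      by_cases e : x' = x
      · subst e
        rcases hy.eq_or_lt with e2 | e2
        · left; rw [e2]
        · right; rw [Finset.mem_coe, mem_iff_lt]; exact e2
      · right; rw [Finset.mem_coe, mem_iff_lt]
        have := μ.rowLen_anti x' (x - 1) (by omega)
        omega
    · right
      exact μ.isLowerSet hle hm

theorem isRemovable_iff (μ : YoungDiagram) (r c : ℕ) :
    IsRemovableCell μ (r, c) ↔ c + 1 = μ.rowLen r ∧ μ.rowLen (r + 1) < μ.rowLen r := by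
  unfold IsRemovableCell
  rw [← YoungDiagram.mem_cells, mem_iff_lt]
  constructor
  · rintro ⟨h1, h2⟩
    have key : ∀ x y, r ≤ x → c ≤ y → y < μ.rowLen x → (x, y) = (r, c) := by
      intro x y hx hy hm
      by_contra hne
      have := h2 (a := (x, y)) (b := (r, c)) ⟨hx, hy⟩
        (by rw [Finset.mem_coe, Finset.mem_erase, mem_iff_lt]; exact ⟨hne, hm⟩)
      simp at this
    constructor
    · by_contra hne
      have := key r (c + 1) le_rfl (by omega) (by omega)
      simp at this
    · by_contra hne
      have := key (r + 1) c (by omega) le_rfl (by omega)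
      simp at this
  · rintro ⟨h1, h2⟩
    refine ⟨by omega, ?_⟩
    rintro ⟨x, y⟩ ⟨x', y'⟩ hle hm
    have hx : x' ≤ x := hle.1
    have hy : y' ≤ y := hle.2
    rw [Finset.mem_coe, Finset.mem_erase, mem_iff_lt] at hm ⊢
    have := μ.rowLen_anti x' x hx
    refine ⟨?_, by omega⟩
    intro e
    simp only [Prod.mk.injEq] at e
    obtain ⟨rfl, rfl⟩ := e
    by_cases e : x = x'
    · subst e; exact hm.1 (by simp; omega)
    · have := μ.rowLen_anti (x' + 1) x (by omega)
      omega

theorem rowLen_le_card (μ : YoungDiagram) (r : ℕ) : μ.rowLen r ≤ μ.cells.card := by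
  have : ((Finset.range (μ.rowLen r)).image fun c => (r, c)) ⊆ μ.cells := by
    intro x hx
    simp only [Finset.mem_image, Finset.mem_range] at hx
    obtain ⟨c, hc, rfl⟩ := hx
    exact (mem_iff_lt μ r c).2 hc
  have h := Finset.card_le_card this
  rwa [Finset.card_image_of_injective _ (fun a b h => by simpa using h), Finset.card_range] at h

theorem row_lt_card (μ : YoungDiagram) (r : ℕ) (h : 0 < μ.rowLen r) : r < μ.cells.card := by
  have : ((Finset.range (r + 1)).image fun c => (c, 0)) ⊆ μ.cells := by
    intro x hx
    simp only [Finset.mem_image, Finset.mem_range] at hx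
    obtain ⟨c, hc, rfl⟩ := hx
    have := μ.rowLen_anti c r (by omega)
    exact (mem_iff_lt μ c 0).2 (by omega)
  have h := Finset.card_le_card this
  rwa [Finset.card_image_of_injective _ (fun a b h => by simpa using h), Finset.card_range] at h

/-- row condition for addable. -/
def AC (j : ZMod ℓ) (L : ℕ → ℕ) (r : ℕ) : Prop :=
  (r = 0 ∨ L r < L (r - 1)) ∧ ((L r : ZMod ℓ) - r) = j

/-- row condition for removable. -/
def RC (j : ZMod ℓ) (L : ℕ → ℕ) (r : ℕ) : Prop :=
  L (r + 1) < L r ∧ ((L r : ZMod ℓ) - 1 - r) = j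

theorem ex_addable_iff (j : ZMod ℓ) (μ : YoungDiagram) (r : ℕ) :
    (∃ c, (r, c) ∈ addables ℓ j μ) ↔ AC ℓ j μ.rowLen r := by
  unfold addables AC res
  simp only [Finset.mem_filter, Finset.mem_product, Finset.mem_range, isAddable_iff]
  constructor
  · rintro ⟨c, -, ⟨rfl, h⟩, h2⟩
    refine ⟨h, ?_⟩
    rw [← h2]; push_cast; rfl
  · rintro ⟨h, h2⟩
    refine ⟨μ.rowLen r, ⟨?_, ?_⟩, ⟨rfl, h⟩, ?_⟩
    · rcases h with h | h
      · omega
      · have := row_lt_card μ (r - 1) (by omega)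
        omega
    · have := rowLen_le_card μ r
      omega
    · rw [← h2]; push_cast; rfl

theorem ex_removable_iff (j : ZMod ℓ) (μ : YoungDiagram) (r : ℕ) :
    (∃ c, (r, c) ∈ removables ℓ j μ) ↔ RC ℓ j μ.rowLen r := by
  unfold removables RC res
  simp only [Finset.mem_filter, isRemovable_iff, mem_iff_lt]
  constructor
  · rintro ⟨c, -, ⟨h1, h⟩, h2⟩
    refine ⟨h, ?_⟩
    rw [← h2, ← h1]; push_cast; ring
  · rintro ⟨h, h2⟩
    obtain ⟨c, hc⟩ : ∃ c, c + 1 = μ.rowLen r := ⟨μ.rowLen r - 1, by omega⟩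
    refine ⟨c, by omega, ⟨hc, h⟩, ?_⟩
    rw [← h2, ← hc]; push_cast; ring

theorem rowLetter_eq (j : ZMod ℓ) (μ : YoungDiagram) (r : ℕ) :
    rowLetter ℓ j μ r = if AC ℓ j μ.rowLen r then some true
      else if RC ℓ j μ.rowLen r then some false else none := by
  unfold rowLetter
  simp only [ex_addable_iff, ex_removable_iff]

theorem not_AC_RC (hℓ : 2 ≤ ℓ) (j : ZMod ℓ) (L : ℕ → ℕ) (r : ℕ)
    (h1 : AC ℓ j L r) (h2 : RC ℓ j L r) : False := by
  have : Fact (1 < ℓ) := ⟨by omega⟩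
  have h : (1 : ZMod ℓ) = 0 := by linear_combination h1.2 - h2.2
  exact one_ne_zero h

/-- stack after processing rows `k + d - 1, ..., k`. -/
def stk (f : ℕ → Option Bool) (p : List (Bool × ℕ)) (k d : ℕ) : List (Bool × ℕ) :=
  ((List.range' k d).reverse.filterMap fun r => (f r).map fun b => (b, r)).foldl cancelStep p

theorem stk_zero (f : ℕ → Option Bool) (p : List (Bool × ℕ)) (k : ℕ) : stk f p k 0 = p := by
  simp [stk]

theorem stk_succ (f : ℕ → Option Bool) (p : List (Bool × ℕ)) (k d : ℕ) :
    stk f p k (d + 1) = match f k with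
      | none => stk f p (k + 1) d
      | some b => cancelStep (stk f p (k + 1) d) (b, k) := by
  unfold stk
  rw [List.range'_succ, List.reverse_cons, List.filterMap_append, List.foldl_append]
  cases h : f k <;> simp [h]

theorem stk_split (f : ℕ → Option Bool) (p : List (Bool × ℕ)) (g e : ℕ) :
    stk f p 0 (g + e) = stk f (stk f p g e) 0 g := by
  unfold stk
  rw [← List.range'_append_1]
  simp [List.filterMap_append, List.foldl_append]

theorem stk_none (f : ℕ → Option Bool) (p : List (Bool × ℕ)) (d : ℕ) :
    ∀ k, (∀ r, k ≤ r → f r = none) → stk f p k d = p := by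
  induction d with
  | zero => intro k _; exact stk_zero f p k
  | succ d ih =>
    intro k h
    rw [stk_succ, h k le_rfl]
    exact ih (k + 1) fun r hr => h r (by omega)

theorem stk_bal (f : ℕ → Option Bool) (p : List (Bool × ℕ)) (d : ℕ) :
    ∀ k, (∀ r, k ≤ r → r < k + d → f r = some false →
        ∃ r', r < r' ∧ r' < k + d ∧ f r' = some true ∧ ∀ x, r < x → x < r' → f x = none) →
      ∃ as : List (Bool × ℕ), stk f p k d = p ++ as ∧ (∀ a ∈ as, a.1 = true) ∧
        ((∃ r', k ≤ r' ∧ r' < k + d ∧ f r' = some true ∧ ∀ x, k ≤ x → x < r' → f x = none) →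
          as ≠ []) := by
  induction d with
  | zero =>
    intro k _
    refine ⟨[], by simp [stk_zero], by simp, ?_⟩
    rintro ⟨r', h1, h2, -⟩; omega
  | succ d ih =>
    intro k h
    obtain ⟨as, h1, h2, h3⟩ := ih (k + 1) (by
      intro r hr hr2 hf
      obtain ⟨r', a, b, c⟩ := h r (by omega) (by omega) hf
      exact ⟨r', a, by omega, c⟩)
    rw [stk_succ]
    cases hk : f k with
    | none =>
      refine ⟨as, h1, h2, ?_⟩
      rintro ⟨r', a, b, c, e⟩
      apply h3
      have : r' ≠ k := by rintro rfl; rw [hk] at c; simp at c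
      exact ⟨r', by omega, by omega, c, fun x hx hx' => e x (by omega) hx'⟩
    | some b =>
      cases b with
      | true =>
        refine ⟨as ++ [(true, k)], ?_, ?_, by simp⟩
        · simp [cancelStep, h1]
        · intro a ha
          simp only [List.mem_append, List.mem_singleton] at ha
          rcases ha with ha | ha
          · exact h2 a ha
          · rw [ha]
      | false =>
        have hne : as ≠ [] := by
          obtain ⟨r', a, b, c, e⟩ := h k le_rfl (by omega) hk
          exact h3 ⟨r', by omega, by omega, c, fun x hx hx' => e x (by omega) hx'⟩
        refine ⟨as.dropLast, ?_, fun a ha => h2 a (List.mem_of_mem_dropLast ha), ?_⟩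
        · have e : (p ++ as).getLast?.map Prod.fst = some true := by
            rw [List.getLast?_append_of_ne_nil _ hne, List.getLast?_eq_getLast_of_ne_nil hne]
            simp [h2 _ (List.getLast_mem hne)]
          simp only [h1, cancelStep, e, and_self, if_true]
          exact List.dropLast_append_of_ne_nil hne
        · rintro ⟨r', a, b, c, e⟩
          rcases a.eq_or_lt with a | a
          · subst a; rw [hk] at c; simp at c
          · have := e k le_rfl a
            rw [hk] at this; simp at this

theorem filter_true_nil (as : List (Bool × ℕ)) (h : ∀ a ∈ as, a.1 = true) :
    (as.filter fun p => p.1 = false) = [] := by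
  rw [List.filter_eq_nil_iff]
  intro a ha
  simp [h a ha]

theorem goodRow_eq (j : ZMod ℓ) (μ : YoungDiagram) :
    goodRow ℓ j μ = (((stk (rowLetter ℓ j μ) [] 0 (μ.cells.card + 2)).filter
      fun p => p.1 = false).getLast?).map Prod.snd := by
  unfold goodRow reduceWord wordP stk
  rw [List.range_eq_range']

theorem letter_none_of (j : ZMod ℓ) (μ : YoungDiagram) (r : ℕ)
    (h1 : ¬ AC ℓ j μ.rowLen r) (h2 : ¬ RC ℓ j μ.rowLen r) : rowLetter ℓ j μ r = none := by
  rw [rowLetter_eq, if_neg h1, if_neg h2]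

theorem letter_true_of (j : ZMod ℓ) (μ : YoungDiagram) (r : ℕ)
    (h1 : AC ℓ j μ.rowLen r) : rowLetter ℓ j μ r = some true := by
  rw [rowLetter_eq, if_pos h1]

theorem RC_of_letter (j : ZMod ℓ) (μ : YoungDiagram) (r : ℕ)
    (h : rowLetter ℓ j μ r = some false) : RC ℓ j μ.rowLen r := by
  rw [rowLetter_eq] at h
  split_ifs at h
  · simp at h
  · assumption

theorem etilde_none (j : ZMod ℓ) (μ : YoungDiagram)
    (h : ∀ r, RC ℓ j μ.rowLen r → ∃ r', r < r' ∧ AC ℓ j μ.rowLen r' ∧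
      ∀ x, r < x → x < r' → ¬ AC ℓ j μ.rowLen x ∧ ¬ RC ℓ j μ.rowLen x) :
    etilde ℓ j μ = none := by
  obtain ⟨as, h1, h2, -⟩ := stk_bal (rowLetter ℓ j μ) [] (μ.cells.card + 2) 0 (by
    intro r _ hr hf
    obtain ⟨r', a, b, c⟩ := h r (RC_of_letter ℓ j μ r hf)
    refine ⟨r', a, ?_, letter_true_of ℓ j μ r' b,
      fun x hx hx' => letter_none_of ℓ j μ x (c x hx hx').1 (c x hx hx').2⟩
    rcases b.1 with b | b
    · omega
    · have := row_lt_card μ (r' - 1) (by omega)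
      omega)
  unfold etilde
  rw [goodRow_eq, h1, List.nil_append, filter_true_nil as h2]
  rfl

theorem etilde_some (hℓ : 2 ≤ ℓ) (j : ZMod ℓ) (μ μ' : YoungDiagram) (g : ℕ)
    (hg : RC ℓ j μ.rowLen g)
    (hgt : ∀ r, g < r → ¬ AC ℓ j μ.rowLen r ∧ ¬ RC ℓ j μ.rowLen r)
    (h : ∀ r, r < g → RC ℓ j μ.rowLen r → ∃ r', r < r' ∧ r' < g ∧ AC ℓ j μ.rowLen r' ∧
      ∀ x, r < x → x < r' → ¬ AC ℓ j μ.rowLen x ∧ ¬ RC ℓ j μ.rowLen x)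
    (hμ : ∀ r, μ'.rowLen r = if r = g then μ.rowLen g - 1 else μ.rowLen r) :
    etilde ℓ j μ = some μ' := by
  have hlt := row_lt_card μ g (by have := hg.1; omega)
  have hfg : rowLetter ℓ j μ g = some false := by
    rw [rowLetter_eq, if_neg (fun h => not_AC_RC ℓ hℓ j _ g h hg), if_pos hg]
  obtain ⟨e, he⟩ : ∃ e, μ.cells.card + 2 = g + (e + 1) := ⟨μ.cells.card + 1 - g, by omega⟩
  have h0 : stk (rowLetter ℓ j μ) [] g (e + 1) = [(false, g)] := by
    rw [stk_succ, hfg, stk_none _ _ _ _ (fun r hr =>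
      letter_none_of ℓ j μ r (hgt r (by omega)).1 (hgt r (by omega)).2)]
    simp [cancelStep]
  obtain ⟨as, h1, h2, -⟩ := stk_bal (rowLetter ℓ j μ) [(false, g)] g 0 (by
    intro r _ hr hf
    obtain ⟨r', a, b, c, d⟩ := h r (by omega) (RC_of_letter ℓ j μ r hf)
    exact ⟨r', a, by omega, letter_true_of ℓ j μ r' c,
      fun x hx hx' => letter_none_of ℓ j μ x (d x hx hx').1 (d x hx hx').2⟩)
  have hgood : goodRow ℓ j μ = some g := by
    rw [goodRow_eq, he, stk_split, h0, h1, List.filter_append, filter_true_nil as h2]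
    simp
  unfold etilde
  rw [hgood, Option.map_some]
  congr 1
  have hrem : IsRemovableCell μ (g, μ.rowLen g - 1) := by
    rw [isRemovable_iff]; have := hg.1; exact ⟨by omega, this⟩
  unfold eraseCell
  rw [dif_pos hrem.2]
  apply YoungDiagram.ext
  ext ⟨r, c⟩
  simp only [Finset.mem_erase, mem_iff_lt, hμ, ne_eq, Prod.mk.injEq]
  by_cases hr : r = g
  · subst hr; simp; omega
  · simp [hr]

theorem rowLen_getD (μ : YoungDiagram) (r : ℕ) : μ.rowLen r = μ.rowLens.getD r 0 := by
  by_cases h : r < μ.colLen 0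
  · rw [List.getD_eq_getElem _ _ (by simpa using h)]
    simp [YoungDiagram.rowLens]
  · rw [List.getD_eq_default _ _ (by simpa using h)]
    by_contra hne
    apply h
    rw [← YoungDiagram.mem_iff_lt_colLen, YoungDiagram.mem_iff_lt_rowLen]
    omega

/-- row length function. -/
def lf (a q s r : ℕ) : ℕ :=
  if r = 0 then a else if r ≤ q then ℓ - 1 else if r = q + 1 then s else 0

theorem getD_lf (a q s r : ℕ) :
    (a :: (List.replicate q (ℓ - 1) ++ (if s = 0 then [] else [s]))).getD r 0 = lf ℓ a q s r := by
  cases r with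
  | zero => simp [lf]
  | succ r =>
    rw [List.getD_cons_succ]
    by_cases h : r < q
    · rw [List.getD_append _ _ _ _ (by simpa using h)]
      have : r + 1 ≤ q := h
      simp [List.getD_eq_getElem?_getD, h, lf, this]
    · rw [List.getD_append_right _ _ _ _ (by simpa using h)]
      have h' : ¬ (r + 1 ≤ q) := by omega
      by_cases h2 : r = q
      · subst h2
        by_cases hs : s = 0 <;> simp [lf, hs]
      · have : lf ℓ a q s (r + 1) = 0 := by simp [lf, h', h2]
        rw [this]
        apply List.getD_eq_default
        by_cases hs : s = 0 <;> simp [hs]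
        omega

theorem natCast_ne (k : ℕ) (h0 : 0 < k) (h : k < ℓ) : (k : ZMod ℓ) ≠ 0 := by
  rw [Ne, ZMod.natCast_eq_zero_iff]
  intro hd
  have := Nat.le_of_dvd h0 hd
  omega

theorem cast_pred (hℓ : 2 ≤ ℓ) : ((ℓ - 1 : ℕ) : ZMod ℓ) = -1 := by
  rw [Nat.cast_sub (by omega)]; simp

theorem RC_lf (hℓ : 2 ≤ ℓ) (a q s r : ℕ) (j : ZMod ℓ) (ha : (a : ZMod ℓ) = -1)
    (h : RC ℓ j (lf ℓ a q s) r) :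
    (r = 0 ∧ 1 ≤ q ∧ ℓ - 1 < a ∧ j = -2) ∨ (r = q ∧ j = -2 - q) ∨
      (r = q + 1 ∧ 0 < s ∧ j = s - q - 2) := by
  obtain ⟨h1, h2⟩ := h
  have hc := cast_pred ℓ hℓ
  by_cases hr : r = 0
  · subst hr
    have e0 : lf ℓ a q s 0 = a := by simp [lf]
    have hj : j = -2 := by
      rw [← h2, e0, ha]; push_cast; ring
    by_cases hq : q = 0
    · subst hq; right; left; exact ⟨rfl, by rw [hj]; simp⟩
    · left
      have e1 : lf ℓ a q s (0 + 1) = ℓ - 1 := by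
        unfold lf; rw [if_neg (by omega), if_pos (by omega)]
      rw [e0, e1] at h1
      exact ⟨rfl, by omega, h1, hj⟩
  · right
    by_cases hrq : r ≤ q
    · left
      have e0 : lf ℓ a q s r = ℓ - 1 := by
        unfold lf; rw [if_neg hr, if_pos hrq]
      have : r = q := by
        by_contra hne
        have e1 : lf ℓ a q s (r + 1) = ℓ - 1 := by
          unfold lf; rw [if_neg (by omega), if_pos (by omega)]
        omega
      refine ⟨this, ?_⟩
      rw [← h2, e0, hc, this]; ring
    · right
      by_cases hr1 : r = q + 1
      · have e0 : lf ℓ a q s r = s := by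
          unfold lf; rw [if_neg hr, if_neg hrq, if_pos hr1]
        refine ⟨hr1, by omega, ?_⟩
        rw [← h2, e0, hr1]; push_cast; ring
      · have e0 : lf ℓ a q s r = 0 := by
          unfold lf; rw [if_neg hr, if_neg hrq, if_neg hr1]
        omega

theorem AC_lf (hℓ : 2 ≤ ℓ) (a q s r : ℕ) (j : ZMod ℓ) (ha : (a : ZMod ℓ) = -1)
    (h : AC ℓ j (lf ℓ a q s) r) :
    (r = 0 ∧ j = -1) ∨ (r = 1 ∧ 1 ≤ q ∧ j = -2) ∨ (r = q + 1 ∧ j = s - q - 1) ∨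
      (r = q + 2 ∧ 0 < s ∧ j = -2 - q) := by
  obtain ⟨h1, h2⟩ := h
  have hc := cast_pred ℓ hℓ
  by_cases hr : r = 0
  · left
    subst hr
    have e0 : lf ℓ a q s 0 = a := by simp [lf]
    refine ⟨rfl, ?_⟩
    rw [← h2, e0, ha]; push_cast; ring
  · right
    replace h1 := h1.resolve_left hr
    by_cases hrq : r ≤ q
    · left
      have e0 : lf ℓ a q s r = ℓ - 1 := by
        unfold lf; rw [if_neg hr, if_pos hrq]
      have : r = 1 := by
        by_contra hne
        have e1 : lf ℓ a q s (r - 1) = ℓ - 1 := by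
          unfold lf; rw [if_neg (by omega), if_pos (by omega)]
        omega
      refine ⟨this, by omega, ?_⟩
      rw [← h2, e0, hc, this]; push_cast; ring
    · right
      by_cases hr1 : r = q + 1
      · left
        have e0 : lf ℓ a q s r = s := by
          unfold lf; rw [if_neg hr, if_neg hrq, if_pos hr1]
        refine ⟨hr1, ?_⟩
        rw [← h2, e0, hr1]; push_cast; ring
      · right
        have e0 : lf ℓ a q s r = 0 := by
          unfold lf; rw [if_neg hr, if_neg hrq, if_neg hr1]
        have e2 : r = q + 2 := by
          by_contra hne
          have e1 : lf ℓ a q s (r - 1) = 0 := by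
            unfold lf; rw [if_neg (by omega), if_neg (by omega), if_neg (by omega)]
          omega
        have e1 : lf ℓ a q s (r - 1) = s := by
          unfold lf; rw [if_neg (by omega), if_neg (by omega), if_pos (by omega)]
        refine ⟨e2, by omega, ?_⟩
        rw [← h2, e0, e2]; push_cast; ring

theorem AC_one (hℓ : 2 ≤ ℓ) (a q s : ℕ) (hq : 1 ≤ q) (ha : ℓ - 1 < a) :
    AC ℓ (-2) (lf ℓ a q s) 1 := by
  have e0 : lf ℓ a q s 0 = a := by simp [lf]
  have e1 : lf ℓ a q s 1 = ℓ - 1 := by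
    unfold lf; rw [if_neg (by omega), if_pos (by omega)]
  refine ⟨Or.inr ?_, ?_⟩
  · rw [e1]; simpa [e0] using ha
  · rw [e1, cast_pred ℓ hℓ]; push_cast; ring

theorem AC_bot (a q s : ℕ) (hs : 0 < s) :
    AC ℓ (-2 - q) (lf ℓ a q s) (q + 2) := by
  have e0 : lf ℓ a q s (q + 2) = 0 := by
    unfold lf; rw [if_neg (by omega), if_neg (by omega), if_neg (by omega)]
  have e1 : lf ℓ a q s (q + 2 - 1) = s := by
    unfold lf; rw [if_neg (by omega), if_neg (by omega), if_pos (by omega)]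
  refine ⟨Or.inr ?_, ?_⟩
  · rw [e0, e1]; exact hs
  · rw [e0]; push_cast; ring

theorem core_none (hℓ : 2 ≤ ℓ) (a q s : ℕ) (j : ZMod ℓ) (ha : (a : ZMod ℓ) = -1)
    (hs : s + 2 ≤ ℓ) (hj : j ≠ s - q - 2) (r : ℕ) (h : RC ℓ j (lf ℓ a q s) r) :
    ∃ r', r < r' ∧ AC ℓ j (lf ℓ a q s) r' ∧
      ∀ x, r < x → x < r' → ¬ AC ℓ j (lf ℓ a q s) x ∧ ¬ RC ℓ j (lf ℓ a q s) x := by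
  rcases RC_lf ℓ hℓ a q s r j ha h with ⟨rfl, h1, h2, rfl⟩ | ⟨rfl, rfl⟩ | ⟨rfl, h1, h2⟩
  · exact ⟨1, by omega, AC_one ℓ hℓ a q s h1 h2, fun x _ _ => by omega⟩
  · have hs0 : 0 < s := by
      rcases Nat.eq_zero_or_pos s with h0 | h0
      · subst h0; exact absurd (by push_cast; ring) hj
      · exact h0
    refine ⟨r + 2, by omega, AC_bot ℓ a r s hs0, ?_⟩
    intro x hx hx'
    obtain rfl : x = r + 1 := by omega
    constructor
    · intro h
      rcases AC_lf ℓ hℓ a r s _ _ ha h with h | h | h | h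
      · omega
      · omega
      · apply natCast_ne ℓ (s + 1) (by omega) (by omega)
        push_cast
        linear_combination -h.2
      · omega
    · intro h
      rcases RC_lf ℓ hℓ a r s _ _ ha h with h | h | h
      · omega
      · omega
      · exact hj h.2.2
  · exact absurd h2 hj

theorem core_some (hℓ : 2 ≤ ℓ) (a q s : ℕ) (j : ZMod ℓ) (ha : (a : ZMod ℓ) = -1)
    (ha' : ℓ - 1 ≤ a) (hqs : 1 ≤ q + s)
    (hs : s + 2 ≤ ℓ) (hj : j = s - q - 2) (μ μ' : YoungDiagram)
    (hμ : μ.rowLen = lf ℓ a q s)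
    (hμ' : ∀ r, μ'.rowLen r = if r = (if s = 0 then q else q + 1)
      then lf ℓ a q s (if s = 0 then q else q + 1) - 1 else lf ℓ a q s r) :
    etilde ℓ j μ = some μ' := by
  have : Fact (1 < ℓ) := ⟨by omega⟩
  have hone : (1 : ZMod ℓ) ≠ 0 := one_ne_zero
  apply etilde_some ℓ hℓ j μ μ' (if s = 0 then q else q + 1)
  · rw [hμ]
    by_cases h0 : s = 0
    · rw [if_pos h0]
      have e0 : lf ℓ a q s q = ℓ - 1 := by
        unfold lf; rw [if_neg (by omega), if_pos (by omega)]
      have e1 : lf ℓ a q s (q + 1) = 0 := by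
        unfold lf; rw [if_neg (by omega), if_neg (by omega), if_pos (by omega), h0]
      refine ⟨by omega, ?_⟩
      rw [e0, cast_pred ℓ hℓ, hj, h0]; push_cast; ring
    · rw [if_neg h0]
      have e0 : lf ℓ a q s (q + 1) = s := by
        unfold lf; rw [if_neg (by omega), if_neg (by omega), if_pos (by omega)]
      have e1 : lf ℓ a q s (q + 1 + 1) = 0 := by
        unfold lf; rw [if_neg (by omega), if_neg (by omega), if_neg (by omega)]
      refine ⟨by omega, ?_⟩
      rw [e0, hj]; push_cast; ring
  · rw [hμ]
    intro r hr
    constructor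
    · intro h
      rcases AC_lf ℓ hℓ a q s _ _ ha h with h | h | h | h
      · omega
      · split_ifs at hr <;> omega
      · apply hone
        linear_combination hj - h.2
      · apply natCast_ne ℓ s (by omega) (by omega)
        linear_combination h.2.2 - hj
    · intro h
      rcases RC_lf ℓ hℓ a q s _ _ ha h with h | h | h
      · omega
      · split_ifs at hr <;> omega
      · split_ifs at hr <;> omega
  · rw [hμ]
    intro r hr h
    rcases RC_lf ℓ hℓ a q s _ _ ha h with ⟨rfl, h1, h2, h3⟩ | ⟨rfl, h1⟩ | h
    · refine ⟨1, by omega, ?_, h3 ▸ AC_one ℓ hℓ a q s h1 h2, fun x _ _ => by omega⟩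
      by_contra hne
      split_ifs at hne with h0
      · obtain rfl : q = 1 := by omega
        subst h0
        apply hone
        push_cast at hj
        linear_combination hj - h3
      · omega
    · exfalso
      split_ifs at hr with h0
      · omega
      · apply natCast_ne ℓ s (by omega) (by omega)
        linear_combination h1 - hj
    · exfalso
      split_ifs at hr <;> omega
  · rw [hμ]; exact hμ'

theorem lf_step (hℓ : 2 ≤ ℓ) (a R : ℕ) (hR : 1 ≤ R) (r : ℕ) :
    lf ℓ a ((R - 1) / (ℓ - 1)) ((R - 1) % (ℓ - 1)) r =
      if r = (if R % (ℓ - 1) = 0 then R / (ℓ - 1) else R / (ℓ - 1) + 1)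
      then lf ℓ a (R / (ℓ - 1)) (R % (ℓ - 1))
        (if R % (ℓ - 1) = 0 then R / (ℓ - 1) else R / (ℓ - 1) + 1) - 1
      else lf ℓ a (R / (ℓ - 1)) (R % (ℓ - 1)) r := by
  obtain ⟨m, hm⟩ : ∃ m, m = ℓ - 1 := ⟨_, rfl⟩
  have hm0 : 0 < m := by omega
  have hd := Nat.div_add_mod R m
  have hlt := Nat.mod_lt R hm0
  unfold lf
  rw [← hm]
  generalize hq : R / m = q at *
  generalize hs : R % m = s at *
  by_cases h0 : s = 0
  · subst h0
    obtain ⟨k, rfl⟩ : ∃ k, q = k + 1 := by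
      refine ⟨q - 1, ?_⟩
      rcases Nat.eq_zero_or_pos q with h | h
      · subst h; simp at hd; omega
      · omega
    have e : R - 1 = m * k + (m - 1) := by
      rw [← hd]; rw [Nat.mul_add]; omega
    have e1 : (R - 1) / m = k := by
      rw [e, Nat.mul_add_div hm0, Nat.div_eq_of_lt (by omega)]; omega
    have e2 : (R - 1) % m = m - 1 := by
      rw [e, Nat.mul_add_mod, Nat.mod_eq_of_lt (by omega)]
    rw [e1, e2]
    simp only [if_true]
    split_ifs <;> first | contradiction | omega | rfl
  · have e : R - 1 = m * q + (s - 1) := by omega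
    have e1 : (R - 1) / m = q := by
      rw [e, Nat.mul_add_div hm0, Nat.div_eq_of_lt (by omega)]; omega
    have e2 : (R - 1) % m = s - 1 := by
      rw [e, Nat.mul_add_mod, Nat.mod_eq_of_lt (by omega)]
    rw [e1, e2]
    simp only [h0, if_false]
    split_ifs <;> first | contradiction | omega | rfl

/-- Assume `n ≥ 2` and `ℓ ∤ n`.  Then for every `0 ≤ i ≤ N = ⌊n/ℓ⌋` and
every residue `j ∈ ℤ/ℓ`: if `j ≢ n-1 (mod ℓ)` then `ẽⱼ μ_i^{(n)} = 0`, while if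
`j ≡ n-1 (mod ℓ)` then `ẽⱼ μ_i^{(n)} = μ_i^{(n-1)}` (which is defined, since
`⌊(n-1)/ℓ⌋ = N` when `ℓ ∤ n`).  Partitions are encoded as Young diagrams and specified by
their lists of row lengths. -/
theorem statement12 (n : ℕ) (hℓ : 2 ≤ ℓ) (hn : 2 ≤ n) (hmod : ¬ ℓ ∣ n) :
    ∀ i : ℕ, i ≤ n / ℓ →
      ∀ μ μ' : YoungDiagram,
        μ.rowLens = muList ℓ n i → μ'.rowLens = muList ℓ (n - 1) i →
        ∀ j : ZMod ℓ,
          (j ≠ ((n - 1 : ℕ) : ZMod ℓ) → etilde ℓ j μ = none)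
          ∧ (j = ((n - 1 : ℕ) : ZMod ℓ) → etilde ℓ j μ = some μ') := by
  intro i hi μ μ' h h' j
  have hfact : Fact (1 < ℓ) := ⟨by omega⟩
  have hone : (1 : ZMod ℓ) ≠ 0 := one_ne_zero
  have hn1 : ((n - 1 : ℕ) : ZMod ℓ) = n - 1 := by
    rw [Nat.cast_sub (by omega)]; simp
  have hn0 : (n : ZMod ℓ) ≠ 0 := by rwa [Ne, ZMod.natCast_eq_zero_iff]
  rw [hn1]
  by_cases hi0 : i = 0
  · subst hi0
    have hL : ∀ r, μ.rowLen r = if r = 0 then n else 0 := by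
      intro r
      rw [rowLen_getD, h]
      cases r <;> simp [muList]
    have hL' : ∀ r, μ'.rowLen r = if r = 0 then n - 1 else 0 := by
      intro r
      rw [rowLen_getD, h']
      cases r <;> simp [muList]
    have hRC : ∀ r, RC ℓ j μ.rowLen r → r = 0 ∧ j = n - 1 := by
      intro r hr
      obtain ⟨h1, h2⟩ := hr
      rw [hL, hL] at h1
      have : r = 0 := by
        by_contra hne
        simp [hne] at h1
      subst this
      refine ⟨rfl, ?_⟩
      rw [← h2, hL]; simp
    constructor
    · intro hj
      apply etilde_none
      intro r hr
      exact absurd (hRC r hr).2 hj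
    · intro hj
      apply etilde_some ℓ hℓ j μ μ' 0
      · refine ⟨?_, ?_⟩
        · rw [hL, hL]; simp; omega
        · rw [hL, hj]; simp
      · intro r hr
        constructor
        · rintro ⟨h1, h2⟩
          have h1 := h1.resolve_left (by omega)
          rw [hL, hL, if_neg (by omega)] at h1
          have : r = 1 := by
            by_contra hne
            rw [if_neg (by omega)] at h1
            omega
          subst this
          rw [hL, if_neg (by omega)] at h2
          apply hn0
          push_cast at h2
          linear_combination - hj - h2
        · intro h
          have := (hRC r h).1
          omega
      · intro r hr; omega
      · intro r
        rw [hL', hL, hL]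
        by_cases hr : r = 0 <;> simp [hr]
  · have hdm := Nat.div_add_mod n ℓ
    have htl := Nat.mod_lt n (show 0 < ℓ by omega)
    have ht0 : 0 < n % ℓ := by
      rcases Nat.eq_zero_or_pos (n % ℓ) with h0 | h0
      · exact absurd (Nat.dvd_of_mod_eq_zero h0) hmod
      · exact h0
    have hN : (n - 1) / ℓ = n / ℓ := by
      have e : n - 1 = ℓ * (n / ℓ) + (n % ℓ - 1) := by omega
      rw [e, Nat.mul_add_div (by omega), Nat.div_eq_of_lt (a := n % ℓ - 1) (by omega)]
      omega
    obtain ⟨a, hadef⟩ : ∃ a, a = (n / ℓ - i) * ℓ + (ℓ - 1) := ⟨_, rfl⟩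
    have hale : a + 1 ≤ n := by
      have : (n / ℓ - i + 1) * ℓ ≤ (n / ℓ) * ℓ := Nat.mul_le_mul_right _ (by omega)
      rw [Nat.add_mul, Nat.mul_comm (n / ℓ) ℓ] at this
      omega
    have ha : (a : ZMod ℓ) = -1 := by
      rw [hadef]; push_cast; rw [cast_pred ℓ hℓ]; simp
    obtain ⟨R, hR⟩ : ∃ R, R = n - a := ⟨_, rfl⟩
    have hL : μ.rowLen = lf ℓ a (R / (ℓ - 1)) (R % (ℓ - 1)) := by
      funext r
      rw [rowLen_getD, h, muList, if_neg hi0, ← hadef, ← hR, getD_lf]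
    have hL' : μ'.rowLen = lf ℓ a ((R - 1) / (ℓ - 1)) ((R - 1) % (ℓ - 1)) := by
      funext r
      rw [rowLen_getD, h', muList, if_neg hi0, hN, ← hadef,
        show n - 1 - a = R - 1 by omega, getD_lf]
    have hdR := Nat.div_add_mod R (ℓ - 1)
    have hs := Nat.mod_lt R (show 0 < ℓ - 1 by omega)
    have hcast : (n : ZMod ℓ) - 1 = (R % (ℓ - 1) : ℕ) - (R / (ℓ - 1) : ℕ) - 2 := by
      have e : n = a + ((ℓ - 1) * (R / (ℓ - 1)) + R % (ℓ - 1)) := by omega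
      have e2 : (n : ZMod ℓ) = (a + ((ℓ - 1) * (R / (ℓ - 1)) + R % (ℓ - 1)) : ℕ) :=
        congrArg _ e
      rw [e2, Nat.cast_add, Nat.cast_add, Nat.cast_mul, cast_pred ℓ hℓ, ha]
      ring
    rw [hcast]
    constructor
    · intro hj
      apply etilde_none
      rw [hL]
      exact core_none ℓ hℓ a _ _ j ha (by omega) hj
    · intro hj
      apply core_some ℓ hℓ a _ _ j ha (by omega) ?_ (by omega) hj μ μ' hL
      · intro r
        rw [hL', lf_step ℓ hℓ a R (by omega) r]
      · rcases Nat.eq_zero_or_pos (R / (ℓ - 1)) with e1 | e1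
        · rw [e1] at hdR ⊢
          rw [Nat.mul_zero] at hdR
          omega
        · exact le_trans e1 (Nat.le_add_right _ _)


end FockCrystal
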